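/- The Stieltjes transform m(z) of the Marcenko-Pastur distribution with parameters (σ², c) satisfies the fixed-point equation m(z) = 1/(-z + σ²/(1 + σ² c m(z))) for all z in the upper half-plane. -/

import Mathlib

open MeasureTheory

/-- The Marcenko-Pastur distribution with parameters `(σ2, c)`. -/
noncomputable def mpMeasure (σ2 c : ℝ) : Measure ℝ :=
  ENNReal.ofReal (max (1 - c⁻¹) 0) • Measure.dirac 0 +
    volume.withDensity (fun x =>
      ENNReal.ofReal (Set.indicator
        (Set.Icc (σ2 * (1 - Real.sqrt c) ^ 2) (σ2 * (1 + Real.sqrt c) ^ 2))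
        (fun t => Real.sqrt ((t - σ2 * (1 - Real.sqrt c) ^ 2) *
            (σ2 * (1 + Real.sqrt c) ^ 2 - t)) / (2 * σ2 * c * Real.pi * t)) x))

/-- The Stieltjes transform of a measure on `ℝ`. -/
noncomputable def stieltjesTransform (μ : Measure ℝ) (z : ℂ) : ℂ :=
  ∫ t, ((t : ℂ) - z)⁻¹ ∂μ

lemma mp_zeta (w : ℂ) (hw : w.im ≠ 0) : ∃ ζ : ℂ, ζ ≠ 0 ∧ ‖ζ‖ < 1 ∧ w = (ζ + ζ⁻¹) / 2 := by
  obtain ⟨q, hq⟩ := IsAlgClosed.exists_pow_nat_eq (w ^ 2 - 1) (n := 2) (by norm_num)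
  have h1 : (w + q) * (w - q) = 1 := by linear_combination -hq
  have hp0 : w + q ≠ 0 := left_ne_zero_of_mul_eq_one h1
  have hi : (w + q)⁻¹ = w - q := inv_eq_of_mul_eq_one_right h1
  have hn : ‖w + q‖ ≠ 1 := by
    intro h
    have : (w + q)⁻¹ = (starRingEnd ℂ) (w + q) := Complex.inv_eq_conj h
    rw [hi] at this
    have h3 : (w - q).im = -(w + q).im := by rw [this, Complex.conj_im]
    simp at h3
    apply hw; linarith
  rcases lt_or_gt_of_ne hn with h | h
  · exact ⟨w + q, hp0, h, by rw [hi]; ring⟩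
  · refine ⟨w - q, right_ne_zero_of_mul_eq_one h1, ?_, ?_⟩
    · rw [← hi, norm_inv]; exact inv_lt_one_of_one_lt₀ h
    · rw [← hi, inv_inv, hi]; ring

lemma mp_slit (ζ : ℂ) (h1 : ‖ζ‖ < 1) (u : ℂ) (hu : ‖u‖ = 1) : 1 - ζ * u ∈ Complex.slitPlane := by
  have := Complex.mem_slitPlane_of_norm_lt_one (z := -(ζ * u)) (by simpa [hu] using h1)
  simpa [sub_eq_add_neg] using this

lemma mp_poisson (ζ : ℂ) (h1 : ‖ζ‖ < 1) (w : ℂ) (h0 : ζ ≠ 0) (hw : w = (ζ + ζ⁻¹) / 2) :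
    (∫ θ in (0:ℝ)..Real.pi, ((Real.sin θ : ℂ)) ^ 2 / (w - (Real.cos θ : ℂ))) = Real.pi * ζ := by
  have hu : ∀ θ : ℝ, ‖Complex.exp (Complex.I * θ)‖ = 1 := fun θ => by
    rw [mul_comm]; exact Complex.norm_exp_ofReal_mul_I θ
  have hv : ∀ θ : ℝ, ‖Complex.exp (-(Complex.I * θ))‖ = 1 := fun θ => by
    rw [Complex.exp_neg, norm_inv, hu, inv_one]
  have hζ2 : 1 - ζ ^ 2 ≠ 0 := by
    intro h
    have : ‖ζ‖ ^ 2 = 1 := by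
      rw [← norm_pow, show ζ ^ 2 = 1 by linear_combination -h, norm_one]
    nlinarith [norm_nonneg ζ]
  have hcos : ∀ θ : ℝ, (Real.cos θ : ℂ) = (Complex.exp (Complex.I * θ) + Complex.exp (-(Complex.I * θ))) / 2 := by
    intro θ; rw [Complex.ofReal_cos, Complex.cos]; ring_nf
  have hprod : ∀ θ : ℝ, (1 - ζ * Complex.exp (Complex.I * θ)) * (1 - ζ * Complex.exp (-(Complex.I * θ)))
      = 2 * ζ * (w - Real.cos θ) := by
    intro θ
    have e : Complex.exp (Complex.I * θ) * Complex.exp (-(Complex.I * θ)) = 1 := by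
      rw [← Complex.exp_add]; simp
    rw [hcos, hw]
    field_simp
    linear_combination ζ ^ 2 * e
  have hne : ∀ θ : ℝ, w - Real.cos θ ≠ 0 := by
    intro θ h
    have := hprod θ
    rw [h, mul_zero] at this
    exact mul_ne_zero (Complex.slitPlane_ne_zero (mp_slit ζ h1 _ (hu θ)))
      (Complex.slitPlane_ne_zero (mp_slit ζ h1 _ (hv θ))) this
  let F : ℝ → ℂ := fun θ => Complex.sin θ + w * θ - (1 - ζ ^ 2) / (2 * ζ) *
    (θ + Complex.I * Complex.log (1 - ζ * Complex.exp (Complex.I * θ))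
      - Complex.I * Complex.log (1 - ζ * Complex.exp (-(Complex.I * θ))))
  have hF : ∀ θ : ℝ, HasDerivAt F (((Real.sin θ : ℂ)) ^ 2 / (w - (Real.cos θ : ℂ))) θ := by
    intro θ
    have hid : HasDerivAt (fun t : ℝ => (t : ℂ)) 1 θ := Complex.ofRealCLM.hasDerivAt
    have hE := ((hid.const_mul Complex.I).cexp.const_mul ζ).const_sub 1
    have hng : HasDerivAt (fun t : ℝ => -(Complex.I * (t : ℂ))) (-(Complex.I * 1)) θ :=
      (hid.const_mul Complex.I).neg
    have hE' := (hng.cexp.const_mul ζ).const_sub 1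
    have hl := (hE.clog_real (mp_slit ζ h1 _ (hu θ))).const_mul Complex.I
    have hl' := (hE'.clog_real (mp_slit ζ h1 _ (hv θ))).const_mul Complex.I
    have hs : HasDerivAt (fun t : ℝ => Complex.sin t) (Complex.cos θ * 1) θ :=
      (Complex.hasDerivAt_sin (θ : ℂ)).comp θ hid
    have := (hs.add (hid.const_mul w)).sub (((hid.add hl).sub hl').const_mul ((1 - ζ ^ 2) / (2 * ζ)))
    refine this.congr_deriv ?_
    have hp := hprod θ
    have hn := hne θ
    have n1 := Complex.slitPlane_ne_zero (mp_slit ζ h1 _ (hu θ))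
    have n2 := Complex.slitPlane_ne_zero (mp_slit ζ h1 _ (hv θ))
    have hsc : (Real.sin θ : ℂ) ^ 2 = 1 - (Real.cos θ : ℂ) ^ 2 := by
      push_cast; linear_combination Complex.sin_sq_add_cos_sq (θ : ℂ)
    have e : Complex.exp (Complex.I * θ) * Complex.exp (-(Complex.I * θ)) = 1 := by
      rw [← Complex.exp_add]; simp
    rw [hsc, ← Complex.ofReal_cos]
    have hP : (1 + Complex.I * (-(ζ * (Complex.exp (Complex.I * θ) * (Complex.I * 1))) / (1 - ζ * Complex.exp (Complex.I * θ))) - Complex.I * (-(ζ * (Complex.exp (-(Complex.I * θ)) * -(Complex.I * 1))) / (1 - ζ * Complex.exp (-(Complex.I * θ))))) = (1 - ζ ^ 2) / (2 * ζ * (w - Real.cos θ)) := by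
      rw [← hp]
      generalize Complex.exp (Complex.I * θ) = u at *
      generalize Complex.exp (-(Complex.I * θ)) = v at *
      field_simp
      simp only [Complex.I_sq]
      linear_combination (-ζ ^ 2) * e
    rw [hP]
    have hw' : 2 * ζ * w = ζ ^ 2 + 1 := by rw [hw]; field_simp
    generalize (Real.cos θ : ℂ) = C at *
    field_simp
    linear_combination (2 * ζ * w + ζ ^ 2 + 1) * hw'
  have hc : Continuous fun θ : ℝ => ((Real.sin θ : ℂ)) ^ 2 / (w - (Real.cos θ : ℂ)) := by
    apply Continuous.div _ _ hne <;> fun_prop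
  rw [intervalIntegral.integral_eq_sub_of_hasDerivAt (fun θ _ => hF θ) (hc.intervalIntegrable _ _)]
  have e1 : Complex.exp (Complex.I * Real.pi) = -1 := by rw [mul_comm]; exact Complex.exp_pi_mul_I
  have e2 : Complex.exp (-(Complex.I * Real.pi)) = -1 := by rw [Complex.exp_neg, e1]; norm_num
  simp only [F, e1, e2, hw]
  simp
  field_simp
  ring

lemma mp_poisson_one :
    (∫ θ in (0:ℝ)..Real.pi, ((Real.sin θ : ℂ)) ^ 2 / ((-1:ℂ) - (Real.cos θ : ℂ))) = Real.pi * (-1) := by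
  have : (∫ θ in (0:ℝ)..Real.pi, ((Real.sin θ : ℂ)) ^ 2 / ((-1:ℂ) - (Real.cos θ : ℂ)))
     = ∫ θ in (0:ℝ)..Real.pi, (((Real.cos θ - 1 : ℝ)) : ℂ) := by
    rw [intervalIntegral.integral_of_le Real.pi_pos.le, intervalIntegral.integral_of_le Real.pi_pos.le,
      integral_Ioc_eq_integral_Ioo, integral_Ioc_eq_integral_Ioo]
    apply setIntegral_congr_fun measurableSet_Ioo
    intro θ hθ
    have h : -1 < Real.cos θ := by
      rw [← Real.cos_pi]; exact Real.cos_lt_cos_of_nonneg_of_le_pi hθ.1.le le_rfl hθ.2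
    have : (Real.sin θ) ^ 2 / (-1 - Real.cos θ) = Real.cos θ - 1 := by
      rw [div_eq_iff (by linarith)]
      nlinarith [Real.sin_sq_add_cos_sq θ]
    show ((Real.sin θ : ℂ)) ^ 2 / ((-1:ℂ) - (Real.cos θ : ℂ)) = ((Real.cos θ - 1 : ℝ) : ℂ)
    rw [← this]; push_cast; rfl
  rw [this, intervalIntegral.integral_ofReal]
  rw [intervalIntegral.integral_sub (Real.continuous_cos.intervalIntegrable _ _) (by simp)]
  simp

noncomputable def mpF (σ2 s θ : ℝ) : ℝ := σ2 * (1 + s ^ 2) + 2 * σ2 * s * Real.cos θ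

noncomputable def mpD (σ2 c t : ℝ) : ℝ := Real.sqrt ((t - σ2 * (1 - Real.sqrt c) ^ 2) *
            (σ2 * (1 + Real.sqrt c) ^ 2 - t)) / (2 * σ2 * c * Real.pi * t)

lemma mpF_image (σ2 s : ℝ) (hσ : 0 < σ2) (hs : 0 < s) :
    mpF σ2 s '' Set.Icc 0 Real.pi = Set.Icc (σ2 * (1 - s) ^ 2) (σ2 * (1 + s) ^ 2) := by
  have h2 : 0 < 2 * σ2 * s := by positivity
  have : mpF σ2 s = (fun x => σ2 * (1 + s ^ 2) + x) ∘ (fun x => 2 * σ2 * s * x) ∘ Real.cos := rfl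
  rw [this, Set.image_comp, Set.image_comp, Real.bijOn_cos.image_eq, Set.image_mul_left_Icc' h2,
    Set.image_const_add_Icc]
  congr 1 <;> ring

lemma mpF_inj (σ2 s : ℝ) (hσ : 0 < σ2) (hs : 0 < s) : Set.InjOn (mpF σ2 s) (Set.Icc 0 Real.pi) := by
  intro x hx y hy h
  apply Real.injOn_cos hx hy
  have h2 : 0 < 2 * σ2 * s := by positivity
  unfold mpF at h
  exact mul_left_cancel₀ h2.ne' (by linarith)

lemma mpF_deriv (σ2 s : ℝ) (x : ℝ) (S : Set ℝ) :
    HasDerivWithinAt (mpF σ2 s) (2 * σ2 * s * (-Real.sin x)) S x :=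
  (((Real.hasDerivAt_cos x).const_mul (2 * σ2 * s)).const_add (σ2 * (1 + s ^ 2))).hasDerivWithinAt

lemma mpF_pos (σ2 s θ : ℝ) (hσ : 0 < σ2) (hs : 0 < s) (hθ : θ ∈ Set.Ioo 0 Real.pi) : 
    0 < mpF σ2 s θ := by
  have h : -1 < Real.cos θ := by
    rw [← Real.cos_pi]; exact Real.cos_lt_cos_of_nonneg_of_le_pi hθ.1.le le_rfl hθ.2
  have : mpF σ2 s θ = σ2 * (1 - s) ^ 2 + 2 * (σ2 * s * (1 + Real.cos θ)) := by unfold mpF; ring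
  have h3 : 0 < σ2 * s * (1 + Real.cos θ) := by
    apply mul_pos (mul_pos hσ hs); linarith
  have : 0 ≤ σ2 * (1 - s) ^ 2 := by positivity
  linarith

lemma mpD_comp (σ2 c θ : ℝ) (hσ : 0 < σ2) (hc : 0 < c) (hθ : θ ∈ Set.Icc 0 Real.pi) :
    |2 * σ2 * Real.sqrt c * (-Real.sin θ)| * mpD σ2 c (mpF σ2 (Real.sqrt c) θ) =
      2 * σ2 / Real.pi * ((Real.sin θ) ^ 2 / mpF σ2 (Real.sqrt c) θ) := by
  have hs : 0 < Real.sqrt c := Real.sqrt_pos.2 hc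
  have hcs : c = Real.sqrt c ^ 2 := (Real.sq_sqrt hc.le).symm
  have h0 := Real.sin_nonneg_of_mem_Icc hθ
  have e : (mpF σ2 (Real.sqrt c) θ - σ2 * (1 - Real.sqrt c) ^ 2) *
            (σ2 * (1 + Real.sqrt c) ^ 2 - mpF σ2 (Real.sqrt c) θ) =
      (2 * σ2 * Real.sqrt c * Real.sin θ) ^ 2 := by
    unfold mpF
    linear_combination (-4 * σ2 ^ 2 * Real.sqrt c ^ 2) * Real.sin_sq_add_cos_sq θ
  rw [mul_neg, abs_neg, abs_of_nonneg (by positivity)]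
  unfold mpD
  rw [e, Real.sqrt_sq (by positivity)]
  generalize mpF σ2 (Real.sqrt c) θ = t
  rw [div_mul_eq_div_div (2 * σ2 * Real.sqrt c * Real.sin θ)]
  have hpi := Real.pi_ne_zero
  have : 2 * σ2 * c * Real.pi = 2 * σ2 * (Real.sqrt c) ^ 2 * Real.pi := by rw [← hcs]
  rw [this]
  field_simp
  try ring

lemma mp_bound (σ2 s θ : ℝ) (hσ : 0 < σ2) (hs : 0 < s) (hθ : θ ∈ Set.Ioo 0 Real.pi) :
    ‖(Real.sin θ) ^ 2 / mpF σ2 s θ‖ ≤ 1 / (σ2 * s) := by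
  have hp := mpF_pos σ2 s θ hσ hs hθ
  rw [Real.norm_of_nonneg (by positivity), div_le_div_iff₀ hp (by positivity)]
  have e : mpF σ2 s θ = σ2 * (1 - s) ^ 2 + 2 * (σ2 * s * (1 + Real.cos θ)) := by unfold mpF; ring
  have h1 : Real.sin θ ^ 2 * (σ2 * s) ≤ 2 * (σ2 * s * (1 + Real.cos θ)) := by
    have : Real.sin θ ^ 2 ≤ 2 * (1 + Real.cos θ) := by
      nlinarith [Real.sin_sq_add_cos_sq θ, sq_nonneg (1 + Real.cos θ)]
    have := mul_le_mul_of_nonneg_right this (mul_pos hσ hs).le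
    linarith
  have : 0 ≤ σ2 * (1 - s) ^ 2 := by positivity
  linarith

lemma mpF_cont (σ2 s : ℝ) : Continuous (mpF σ2 s) := by unfold mpF; fun_prop

lemma mp_int (σ2 s : ℝ) (hσ : 0 < σ2) (hs : 0 < s) :
    IntegrableOn (fun θ => (Real.sin θ) ^ 2 / mpF σ2 s θ) (Set.Icc 0 Real.pi) := by
  rw [integrableOn_Icc_iff_integrableOn_Ioo]
  have : Measurable (fun θ => (Real.sin θ) ^ 2 / mpF σ2 s θ) :=
    (Real.measurable_sin.pow_const 2).div (mpF_cont σ2 s).measurable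
  apply IntegrableOn.of_bound (by simp) this.aestronglyMeasurable (1 / (σ2 * s))
  rw [ae_restrict_iff' measurableSet_Ioo]
  exact Filter.Eventually.of_forall fun θ hθ => mp_bound σ2 s θ hσ hs hθ

lemma mpD_int (σ2 c : ℝ) (hσ : 0 < σ2) (hc : 0 < c) :
    IntegrableOn (mpD σ2 c) (Set.Icc (σ2 * (1 - Real.sqrt c) ^ 2) (σ2 * (1 + Real.sqrt c) ^ 2)) := by
  have hs : 0 < Real.sqrt c := Real.sqrt_pos.2 hc
  rw [← mpF_image σ2 _ hσ hs, integrableOn_image_iff_integrableOn_abs_deriv_smul measurableSet_Icc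
    (fun x _ => mpF_deriv σ2 (Real.sqrt c) x _) (mpF_inj σ2 _ hσ hs)]
  refine IntegrableOn.congr_fun ((mp_int σ2 _ hσ hs).const_mul (2 * σ2 / Real.pi)) ?_ measurableSet_Icc
  intro θ hθ
  exact (mpD_comp σ2 c θ hσ hc hθ).symm

lemma mp_int_sin (σ2 c : ℝ) (hσ : 0 < σ2) (hc : 0 < c) :
    (∫ θ in (0:ℝ)..Real.pi, ((Real.sin θ : ℂ)) ^ 2 / (mpF σ2 (Real.sqrt c) θ : ℂ)) =
      Real.pi / (2 * σ2) * (1 - max (1 - c⁻¹) 0 : ℝ) := by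
  have hs : 0 < Real.sqrt c := Real.sqrt_pos.2 hc
  have hcs : c = Real.sqrt c ^ 2 := (Real.sq_sqrt hc.le).symm
  generalize Real.sqrt c = s at *
  subst hcs
  have hs' : (s : ℂ) ≠ 0 := by exact_mod_cast hs.ne'
  have hσ' : (σ2 : ℂ) ≠ 0 := by exact_mod_cast hσ.ne'
  have key : ∀ η : ℝ, η ≠ 0 → (-s - s⁻¹ = η + η⁻¹) → ∀ θ : ℝ, ((Real.sin θ : ℂ)) ^ 2 / (mpF σ2 s θ : ℂ) =
      (-1 / (2 * σ2 * s)) * (((Real.sin θ : ℂ)) ^ 2 / ((η + (η : ℂ)⁻¹) / 2 - (Real.cos θ : ℂ))) := by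
    intro η hη h θ
    have h' : -(s : ℂ) - (s : ℂ)⁻¹ = η + (η : ℂ)⁻¹ := by exact_mod_cast h
    rw [← h']
    have : (mpF σ2 s θ : ℂ) = (-(2 * σ2 * s)) * ((-(s : ℂ) - (s : ℂ)⁻¹) / 2 - (Real.cos θ : ℂ)) := by
      unfold mpF; push_cast; field_simp; ring
    rw [this, mul_comm (-(2 * (σ2 : ℂ) * s)), div_mul_eq_div_div]
    rw [div_eq_mul_inv _ (-(2 * (σ2 : ℂ) * s)), mul_comm, neg_div, one_div, inv_neg]
  rcases lt_trichotomy s 1 with h | h | h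
  · simp_rw [key (-s) (by simpa using hs.ne') (by rw [inv_neg]; ring)]
    rw [intervalIntegral.integral_const_mul, mp_poisson ((-s : ℝ) : ℂ) (by simpa [abs_of_pos hs] using h) _ 
      (by simpa using hs') rfl]
    have : max (1 - (s ^ 2)⁻¹) 0 = 0 := by
      apply max_eq_right
      have : 1 ≤ (s ^ 2)⁻¹ := (one_le_inv₀ (by positivity)).2 (by nlinarith)
      linarith
    rw [this]; push_cast; field_simp; try ring
  · simp_rw [key (-1) (by norm_num) (by rw [h]; norm_num)]
    have e : (((-1 : ℝ) : ℂ) + ((-1 : ℝ) : ℂ)⁻¹) / 2 = -1 := by norm_num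
    rw [intervalIntegral.integral_const_mul, e, mp_poisson_one, h]
    norm_num
    field_simp
  · simp_rw [key (-s⁻¹) (by simpa using hs.ne') (by rw [inv_neg, inv_inv]; ring)]
    rw [intervalIntegral.integral_const_mul, mp_poisson ((-s⁻¹ : ℝ) : ℂ)
      (by simpa [abs_of_pos hs] using inv_lt_one_of_one_lt₀ h) _ (by simpa using hs') rfl]
    have : max (1 - (s ^ 2)⁻¹) 0 = 1 - (s ^ 2)⁻¹ := by
      apply max_eq_left
      have : (s ^ 2)⁻¹ ≤ 1 := inv_le_one_of_one_le₀ (by nlinarith)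
      linarith
    rw [this]; push_cast; field_simp; try ring

lemma mp_int_main (σ2 c : ℝ) (hσ : 0 < σ2) (hc : 0 < c) (z : ℂ) (hz : 0 < z.im) (ζ : ℂ) (h0 : ζ ≠ 0)
    (h1 : ‖ζ‖ < 1) (hζ : z = σ2 * (1 + (Real.sqrt c : ℂ) * ζ) * (1 + (Real.sqrt c : ℂ) * ζ⁻¹)) :
    (∫ t in Set.Icc (σ2 * (1 - Real.sqrt c) ^ 2) (σ2 * (1 + Real.sqrt c) ^ 2), 
      mpD σ2 c t • ((t : ℂ) - z)⁻¹) =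
      z⁻¹ * (-ζ / (Real.sqrt c) - (1 - max (1 - c⁻¹) 0 : ℝ)) := by
  have hs : 0 < Real.sqrt c := Real.sqrt_pos.2 hc
  have hs' : (Real.sqrt c : ℂ) ≠ 0 := by exact_mod_cast hs.ne'
  have hσ' : (σ2 : ℂ) ≠ 0 := by exact_mod_cast hσ.ne'
  have hpi : (Real.pi : ℂ) ≠ 0 := by exact_mod_cast Real.pi_ne_zero
  have hz0 : z ≠ 0 := by rintro rfl; simp at hz
  have hne : ∀ t : ℝ, (t : ℂ) - z ≠ 0 := by
    intro t h
    have := congrArg Complex.im h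
    simp at this; linarith
  rw [← mpF_image σ2 _ hσ hs, integral_image_eq_integral_abs_deriv_smul measurableSet_Icc
    (fun x _ => mpF_deriv σ2 (Real.sqrt c) x _) (mpF_inj σ2 _ hσ hs)]
  set s := Real.sqrt c with hsdef
  have step : (∫ θ in Set.Icc 0 Real.pi, |2 * σ2 * s * (-Real.sin θ)| • 
      (mpD σ2 c (mpF σ2 s θ) • ((mpF σ2 s θ : ℂ) - z)⁻¹)) =
      ∫ θ in (0:ℝ)..Real.pi, (2 * σ2 / Real.pi * z⁻¹ : ℂ) * ((-1 / (2 * σ2 * s)) * 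
        (((Real.sin θ : ℂ)) ^ 2 / ((ζ + ζ⁻¹) / 2 - (Real.cos θ : ℂ)))
        - ((Real.sin θ : ℂ)) ^ 2 / (mpF σ2 s θ : ℂ)) := by
    rw [intervalIntegral.integral_of_le Real.pi_pos.le, integral_Icc_eq_integral_Ioc,
      integral_Ioc_eq_integral_Ioo, integral_Ioc_eq_integral_Ioo]
    apply setIntegral_congr_fun measurableSet_Ioo
    intro θ hθ
    have hp : (mpF σ2 s θ : ℂ) ≠ 0 := by exact_mod_cast (mpF_pos σ2 s θ hσ hs hθ).ne'
    have hw : (mpF σ2 s θ : ℂ) - z = (-(2 * σ2 * s)) * ((ζ + ζ⁻¹) / 2 - (Real.cos θ : ℂ)) := by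
      rw [hζ]; unfold mpF; push_cast; field_simp; ring
    have hnn : (ζ + ζ⁻¹) / 2 - (Real.cos θ : ℂ) ≠ 0 := by
      intro h; rw [h, mul_zero] at hw; exact hne _ hw
    have e1 : (-1 / (2 * σ2 * s)) * (((Real.sin θ : ℂ)) ^ 2 / ((ζ + ζ⁻¹) / 2 - (Real.cos θ : ℂ)))
        = (Real.sin θ : ℂ) ^ 2 / ((mpF σ2 s θ : ℂ) - z) := by
      rw [hw]
      generalize (ζ + ζ⁻¹) / 2 - (Real.cos θ : ℂ) = y at *
      field_simp
    simp only [e1]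
    rw [smul_smul, mpD_comp σ2 c θ hσ hc ⟨hθ.1.le, hθ.2.le⟩, Complex.real_smul, ← hsdef]
    have := hne (mpF σ2 s θ)
    push_cast
    generalize (mpF σ2 s θ : ℂ) = T at *
    field_simp
    ring
  refine step.trans ?_
  have I1 : IntervalIntegrable (fun θ : ℝ => (-1 / (2 * σ2 * s) : ℂ) * 
        (((Real.sin θ : ℂ)) ^ 2 / ((ζ + ζ⁻¹) / 2 - (Real.cos θ : ℂ)))) volume 0 Real.pi := by
    apply Continuous.intervalIntegrable
    apply Continuous.mul continuous_const
    apply Continuous.div (by fun_prop) (by fun_prop)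
    intro θ h
    apply hne (mpF σ2 s θ)
    have hw : (mpF σ2 s θ : ℂ) - z = (-(2 * σ2 * s)) * ((ζ + ζ⁻¹) / 2 - (Real.cos θ : ℂ)) := by
      rw [hζ]; unfold mpF; push_cast; field_simp; ring
    rw [hw, h, mul_zero]
  have I2 : IntervalIntegrable (fun θ : ℝ => ((Real.sin θ : ℂ)) ^ 2 / (mpF σ2 s θ : ℂ)) volume 0 Real.pi := by
    rw [intervalIntegrable_iff_integrableOn_Icc_of_le Real.pi_pos.le]
    have := (mp_int σ2 s hσ hs).ofReal (𝕜 := ℂ)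
    simpa [IntegrableOn] using this
  rw [intervalIntegral.integral_const_mul, intervalIntegral.integral_sub I1 I2, mp_int_sin σ2 c hσ hc,
    intervalIntegral.integral_const_mul, mp_poisson ζ h1 _ h0 rfl]
  generalize (1 - max (1 - c⁻¹) 0 : ℝ) = M
  field_simp
  try ring

lemma mp_stieltjes (σ2 c : ℝ) (hσ : 0 < σ2) (hc : 0 < c) (z : ℂ) (hz : 0 < z.im) :
    stieltjesTransform (mpMeasure σ2 c) z = (max (1 - c⁻¹) 0 : ℝ) * (-z⁻¹) +
      ∫ t in Set.Icc (σ2 * (1 - Real.sqrt c) ^ 2) (σ2 * (1 + Real.sqrt c) ^ 2), 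
      mpD σ2 c t • ((t : ℂ) - z)⁻¹ := by
  have hne : ∀ t : ℝ, (t : ℂ) - z ≠ 0 := by
    intro t h
    have := congrArg Complex.im h
    simp at this; linarith
  have hcont : Continuous fun t : ℝ => ((t : ℂ) - z)⁻¹ := by
    apply Continuous.inv₀ (by fun_prop) hne
  have hbd : ∀ t : ℝ, ‖((t : ℂ) - z)⁻¹‖ ≤ (z.im)⁻¹ := by
    intro t
    rw [norm_inv]
    apply inv_anti₀ hz
    have := Complex.abs_im_le_norm ((t : ℂ) - z)
    simp [abs_of_pos hz] at this
    exact this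
  set J := Set.Icc (σ2 * (1 - Real.sqrt c) ^ 2) (σ2 * (1 + Real.sqrt c) ^ 2) with hJ
  have hDm : Measurable (mpD σ2 c) := by unfold mpD; fun_prop
  have hint : Integrable (J.indicator (mpD σ2 c)) := 
    (integrable_indicator_iff measurableSet_Icc).2 (mpD_int σ2 c hσ hc)
  have hpos : ∀ t, 0 ≤ J.indicator (mpD σ2 c) t := by
    intro t
    apply Set.indicator_nonneg
    intro t ht
    have : 0 ≤ t := le_trans (by positivity) ht.1
    unfold mpD
    have := Real.pi_pos
    positivity
  haveI : IsFiniteMeasure (volume.withDensity fun x => ENNReal.ofReal (J.indicator (mpD σ2 c) x)) :=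
    isFiniteMeasure_withDensity_ofReal hint.2
  have hm : mpMeasure σ2 c = ENNReal.ofReal (max (1 - c⁻¹) 0) • Measure.dirac 0 +
    volume.withDensity (fun x => ENNReal.ofReal (J.indicator (mpD σ2 c) x)) := rfl
  unfold stieltjesTransform
  rw [hm, integral_add_measure, integral_smul_measure, integral_dirac,
    integral_withDensity_eq_integral_toReal_smul]
  · congr 1
    · rw [ENNReal.toReal_ofReal (le_max_right _ _), Complex.real_smul]
      simp [← neg_inv]
    · rw [← integral_indicator measurableSet_Icc]
      congr 1
      ext t
      rw [ENNReal.toReal_ofReal (hpos t)]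
      by_cases ht : t ∈ J <;> simp [ht, ← hJ]
  · exact (hDm.indicator measurableSet_Icc).ennreal_ofReal
  · exact Filter.Eventually.of_forall fun x => ENNReal.ofReal_lt_top
  · apply Integrable.smul_measure _ ENNReal.ofReal_ne_top
    exact Integrable.of_bound hcont.aestronglyMeasurable _ (Filter.Eventually.of_forall hbd)
  · exact Integrable.of_bound hcont.aestronglyMeasurable _ (Filter.Eventually.of_forall hbd)

/-- The Stieltjes transform of the Marcenko-Pastur distribution satisfies the
fixed-point equation `m(z) = 1/(-z + σ²/(1 + σ² c m(z)))` on the upper half-plane. -/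
theorem stmt0 (σ2 c : ℝ) (hσ : 0 < σ2) (hc : 0 < c) (z : ℂ) (hz : 0 < z.im) :
    stieltjesTransform (mpMeasure σ2 c) z =
      1 / (-z + (σ2 : ℂ) / (1 + (σ2 : ℂ) * (c : ℂ) * stieltjesTransform (mpMeasure σ2 c) z)) := by
  have hs : 0 < Real.sqrt c := Real.sqrt_pos.2 hc
  have hcs : (c : ℂ) = (Real.sqrt c : ℂ) ^ 2 := by exact_mod_cast (Real.sq_sqrt hc.le).symm
  have hs' : (Real.sqrt c : ℂ) ≠ 0 := by exact_mod_cast hs.ne'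
  have hσ' : (σ2 : ℂ) ≠ 0 := by exact_mod_cast hσ.ne'
  have hz0 : z ≠ 0 := by rintro rfl; simp at hz
  have hr : 0 < 2 * σ2 * Real.sqrt c := by positivity
  obtain ⟨ζ, h0, h1, hw⟩ := mp_zeta ((z - (σ2 * (1 + c) : ℝ)) / (2 * σ2 * Real.sqrt c : ℝ)) (by
    rw [Complex.div_ofReal_im]
    have : (z - (σ2 * (1 + c) : ℝ)).im = z.im := by
      rw [Complex.sub_im, Complex.ofReal_im, sub_zero]
    rw [this]
    positivity)
  have hζ : z = σ2 * (1 + (Real.sqrt c : ℂ) * ζ) * (1 + (Real.sqrt c : ℂ) * ζ⁻¹) := by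
    have hr' : ((2 * σ2 * Real.sqrt c : ℝ) : ℂ) ≠ 0 := by exact_mod_cast hr.ne'
    rw [div_eq_iff hr', sub_eq_iff_eq_add] at hw
    rw [hw]; push_cast; rw [hcs]; field_simp; ring
  rw [mp_stieltjes σ2 c hσ hc z hz, mp_int_main σ2 c hσ hc z hz ζ h0 h1 hζ]
  have n1 : 1 + (Real.sqrt c : ℂ) * ζ ≠ 0 := by
    intro h; rw [h] at hζ; apply hz0; rw [hζ]; ring
  have n2 : ζ + (Real.sqrt c : ℂ) ≠ 0 := by
    intro h; apply hz0
    rw [hζ, show 1 + (Real.sqrt c : ℂ) * ζ⁻¹ = (ζ + (Real.sqrt c : ℂ)) * ζ⁻¹ by field_simp, h]; ring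
  have hm : ((max (1 - c⁻¹) 0 : ℝ) : ℂ) * (-z⁻¹) + z⁻¹ * (-ζ / (Real.sqrt c) - (1 - max (1 - c⁻¹) 0 : ℝ))
      = -ζ / (σ2 * Real.sqrt c * (1 + (Real.sqrt c : ℂ) * ζ)) := by
    have : ((max (1 - c⁻¹) 0 : ℝ) : ℂ) * (-z⁻¹) + z⁻¹ * (-ζ / (Real.sqrt c) - (1 - max (1 - c⁻¹) 0 : ℝ))
      = z⁻¹ * (-ζ / (Real.sqrt c) - 1) := by
      rw [Complex.ofReal_sub, Complex.ofReal_one]; ring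
    rw [this, hζ, show 1 + (Real.sqrt c : ℂ) * ζ⁻¹ = (ζ + (Real.sqrt c : ℂ)) * ζ⁻¹ by field_simp]
    field_simp
    ring
  rw [hm]
  have e1 : 1 + (σ2 : ℂ) * c * (-ζ / (σ2 * Real.sqrt c * (1 + (Real.sqrt c : ℂ) * ζ))) =
      1 / (1 + (Real.sqrt c : ℂ) * ζ) := by
    rw [hcs]; field_simp; ring
  have e2 : -z + (σ2 : ℂ) / (1 / (1 + (Real.sqrt c : ℂ) * ζ)) =
      -(σ2 * (1 + (Real.sqrt c : ℂ) * ζ) * Real.sqrt c * ζ⁻¹) := by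
    rw [hζ]; field_simp; ring
  rw [e1, e2]
  field_simp
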